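/- arXiv:1805.05423 — 2 statements merged into one kernel-verified Lean document; each statement's English description precedes it below -/
import Mathlib

section
/- Let n, p ∈ ℕ and let A be a p × n complex matrix. Let 𝒯 = {T : Fin n → ℂ | A.mulVec T + conj(A).mulVec (conj ∘ T) = 0}, a real subspace of ℂⁿ, and let 𝒯₀ = {(T, S) ∈ ℂⁿ × ℂⁿ | A.mulVec T + conj(A).mulVec S = 0}, a complex subspace of ℂⁿ × ℂⁿ. Then dim_ℝ 𝒯 = dim_ℂ 𝒯₀. -/
open Complex Matrix

theorem map_conj_mulVec_star {m n : Type*} [Fintype n] (A : Matrix m n ℂ) (v : n → ℂ) :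
    (A.map (starRingEnd ℂ)).mulVec (star v) = star (A.mulVec v) := by
  ext i
  simp [Matrix.mulVec, dotProduct]

/-- The real space of vectors `T` with `A T + conj(A) conj(T) = 0`. -/
def conjKer {m n : Type*} [Fintype n] (A : Matrix m n ℂ) : Submodule ℝ (n → ℂ) where
  carrier := {T | A.mulVec T + (A.map (starRingEnd ℂ)).mulVec (star T) = 0}
  zero_mem' := by simp
  add_mem' {S T} hS hT := by
    simp only [Set.mem_ofPred_eq, star_add, Matrix.mulVec_add] at hS hT ⊢
    rw [add_add_add_comm, hS, hT, add_zero]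
  smul_mem' r T hT := by
    simp only [Set.mem_ofPred_eq, star_smul, star_trivial, Matrix.mulVec_smul] at hT ⊢
    rw [← smul_add, hT, smul_zero]

/-- The complex space of pairs `(T, S)` with `A T + conj(A) S = 0`. -/
def pairKer {m n : Type*} [Fintype n] (A : Matrix m n ℂ) : Submodule ℂ ((n → ℂ) × (n → ℂ)) :=
  LinearMap.ker (A.mulVecLin.coprod (A.map (starRingEnd ℂ)).mulVecLin)

section

variable {m n : Type*} [Fintype n] {A : Matrix m n ℂ}

theorem mem_conjKer {T : n → ℂ} :
    T ∈ conjKer A ↔ A.mulVec T + (A.map (starRingEnd ℂ)).mulVec (star T) = 0 :=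
  Iff.rfl

theorem mem_pairKer {P : (n → ℂ) × (n → ℂ)} :
    P ∈ pairKer A ↔ A.mulVec P.1 + (A.map (starRingEnd ℂ)).mulVec P.2 = 0 := by
  simp [pairKer]

theorem mem_conjKer_iff_mem_pairKer {T : n → ℂ} : T ∈ conjKer A ↔ (T, star T) ∈ pairKer A := by
  rw [mem_conjKer, mem_pairKer]

theorem star_swap_mem_pairKer {P : (n → ℂ) × (n → ℂ)} (hP : P ∈ pairKer A) :
    (star P.2, star P.1) ∈ pairKer A := by
  rw [mem_pairKer] at hP ⊢
  have h := congrArg star hP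
  rw [star_add, star_zero, ← map_conj_mulVec_star, ← map_conj_mulVec_star] at h
  have hA : (A.map (starRingEnd ℂ)).map (starRingEnd ℂ) = A := by ext; simp
  rwa [hA, add_comm] at h

theorem half_add_star_mem_conjKer {P : (n → ℂ) × (n → ℂ)} (hP : P ∈ pairKer A) :
    (1 / 2 : ℂ) • (P.1 + star P.2) ∈ conjKer A := by
  rw [mem_conjKer_iff_mem_pairKer]
  convert (pairKer A).smul_mem (1 / 2 : ℂ) ((pairKer A).add_mem hP (star_swap_mem_pairKer hP))
    using 1
  ext i <;> simp <;> ring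

/-- The complex space `pairKer A` is the complexification of `conjKer A`: every element is
uniquely `(u, conj u) + i (v, conj v)` with `u` and `v` in `conjKer A`. -/
noncomputable def conjKerProdEquiv (A : Matrix m n ℂ) :
    (conjKer A × conjKer A) ≃ₗ[ℝ] pairKer A where
  toFun p := ⟨((p.1 : n → ℂ), star (p.1 : n → ℂ)) + I • ((p.2 : n → ℂ), star (p.2 : n → ℂ)),
    (pairKer A).add_mem (mem_conjKer_iff_mem_pairKer.1 p.1.2)
      ((pairKer A).smul_mem I (mem_conjKer_iff_mem_pairKer.1 p.2.2))⟩
  invFun P := (⟨_, half_add_star_mem_conjKer P.2⟩,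
    ⟨_, half_add_star_mem_conjKer ((pairKer A).smul_mem (-I) P.2)⟩)
  map_add' p q := by
    ext i <;> simp <;> ring
  map_smul' r p := by
    ext i <;> simp <;> ring
  left_inv p := by
    ext i <;> simp <;> ring_nf
    simp
  right_inv P := by
    ext i <;> simp <;> ring_nf <;> simp <;> ring

theorem finrank_conjKer_eq_finrank_pairKer (A : Matrix m n ℂ) :
    Module.finrank ℝ (conjKer A) = Module.finrank ℂ (pairKer A) := by
  have h := (conjKerProdEquiv A).finrank_eq
  rw [Module.finrank_prod, finrank_real_of_complex] at h
  lia

end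

/-- For a complex p×n matrix A, the real dimension of the real solution space
𝒯 = {T | A·T + conj(A)·conj(T) = 0} equals the complex dimension of the complex
solution space 𝒯₀ = {(T,S) | A·T + conj(A)·S = 0}. -/
theorem real_dim_eq_complex_dim (n p : ℕ) (A : Matrix (Fin p) (Fin n) ℂ) :
    ∃ (V : Submodule ℝ (Fin n → ℂ))
      (W : Submodule ℂ ((Fin n → ℂ) × (Fin n → ℂ))),
      (∀ T : Fin n → ℂ, T ∈ V ↔
        A.mulVec T + (A.map (starRingEnd ℂ)).mulVec (fun i => (starRingEnd ℂ) (T i)) = 0) ∧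
      (∀ TS : (Fin n → ℂ) × (Fin n → ℂ), TS ∈ W ↔
        A.mulVec TS.1 + (A.map (starRingEnd ℂ)).mulVec TS.2 = 0) ∧
      Module.finrank ℝ V = Module.finrank ℂ W := by
  exact ⟨conjKer A, pairKer A, fun _ => mem_conjKer, fun _ => mem_pairKer,
    finrank_conjKer_eq_finrank_pairKer A⟩
end

section
/- Let n, p, q ∈ ℕ, let A be a p × n complex matrix, let 𝒯 = {T : Fin n → ℂ | A.mulVec T + conj(A).mulVec (conj ∘ T) = 0} and 𝒯₀ = {(T, S) ∈ ℂⁿ × ℂⁿ | A.mulVec T + conj(A).mulVec S = 0}. Suppose J is an n × n complex matrix and Q is a q × n complex matrix such that 𝒯₀ = {(T, S) | T = J.mulVec S and Q.mulVec S = 0}. Then 𝒯 = {J.mulVec S + conj ∘ S | S : Fin n → ℂ, Q.mulVec S = 0}, and dim_ℝ 𝒯 = dim_ℂ {S : Fin n → ℂ | Q.mulVec S = 0}. -/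
open Complex Matrix

/-- If every element of the complex space `W` is uniquely of the form `f x + I • f y`, then the
real dimension of the source of `f` is the complex dimension of `W`. -/
theorem finrank_real_eq_finrank_complex_of_bijective {V W : Type*} [AddCommGroup V] [Module ℝ V]
    [Module.Finite ℝ V] [AddCommGroup W] [Module ℂ W] [Module ℝ W] [IsScalarTower ℝ ℂ W]
    (f : V →ₗ[ℝ] W) (hf : Function.Bijective fun x : V × V => f x.1 + I • f x.2) :
    Module.finrank ℝ V = Module.finrank ℂ W := by
  have : SMulCommClass ℝ ℂ W := IsScalarTower.to_smulCommClass
  let e : (V × V) →ₗ[ℝ] W :=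
    { toFun := fun x => f x.1 + I • f x.2
      map_add' := fun x y => by
        simp only [Prod.fst_add, Prod.snd_add, map_add, smul_add]
        abel
      map_smul' := fun c x => by
        simp only [Prod.smul_fst, Prod.smul_snd, map_smul, smul_add, RingHom.id_apply]
        rw [smul_comm I c] }
  have h := (LinearEquiv.ofBijective e hf).finrank_eq
  rw [Module.finrank_prod] at h
  have h' := Module.finrank_mul_finrank ℝ ℂ W
  rw [Complex.finrank_real_complex] at h'
  omega

/-- Entrywise complex conjugation as a real linear map. -/
noncomputable def conjVec (ι : Type*) : (ι → ℂ) →ₗ[ℝ] (ι → ℂ) :=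
  conjAe.toLinearMap.compLeft ι

theorem conjVec_eq {ι : Type*} (v : ι → ℂ) : conjVec ι v = fun i => (starRingEnd ℂ) (v i) := rfl

@[simp]
theorem conjVec_conjVec {ι : Type*} (v : ι → ℂ) : conjVec ι (conjVec ι v) = v := by
  ext i
  simp [conjVec_eq]

@[simp]
theorem conjVec_smul {ι : Type*} (c : ℂ) (v : ι → ℂ) :
    conjVec ι (c • v) = (starRingEnd ℂ) c • conjVec ι v := by
  ext i
  simp [conjVec_eq]

theorem conjVec_mulVec {m n : Type*} [Fintype n] (A : Matrix m n ℂ) (v : n → ℂ) :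
    conjVec m (A.mulVec v) = (A.map (starRingEnd ℂ)).mulVec (conjVec n v) := by
  ext i
  exact RingHom.map_mulVec (starRingEnd ℂ) A v i

theorem map_conj_mulVec {m n : Type*} [Fintype n] (A : Matrix m n ℂ) (v : n → ℂ) :
    (A.map (starRingEnd ℂ)).mulVec v = conjVec m (A.mulVec (conjVec n v)) := by
  rw [conjVec_mulVec, conjVec_conjVec]

/-- The real subspace of solutions of `A T + conj(A) conj(T) = 0`. -/
noncomputable def realSolutionSpace {m n : Type*} [Fintype n] (A : Matrix m n ℂ) : Submodule ℝ (n → ℂ) :=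
  LinearMap.ker (A.mulVecLin.restrictScalars ℝ +
    (A.map (starRingEnd ℂ)).mulVecLin.restrictScalars ℝ ∘ₗ conjVec n)

theorem mem_realSolutionSpace {m n : Type*} [Fintype n] {A : Matrix m n ℂ} {T : n → ℂ} :
    T ∈ realSolutionSpace A ↔
      A.mulVec T + (A.map (starRingEnd ℂ)).mulVec (conjVec n T) = 0 := Iff.rfl

/-- If `(T, S)` solves `A T + conj(A) S = 0`, then `T + conj(S)` is a real solution. -/
theorem add_conjVec_mem_realSolutionSpace {m n : Type*} [Fintype n] {A : Matrix m n ℂ}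
    {T S : n → ℂ} (h : A.mulVec T + (A.map (starRingEnd ℂ)).mulVec S = 0) :
    T + conjVec n S ∈ realSolutionSpace A := by
  have h' := congrArg (conjVec m) h
  rw [map_add, map_zero, map_conj_mulVec, conjVec_conjVec, conjVec_mulVec] at h'
  rw [mem_realSolutionSpace, map_add, conjVec_conjVec, mulVec_add, mulVec_add]
  linear_combination h + h'

/-- If 𝒯₀ = {(T,S) | A·T + conj(A)·S = 0} is parametrized as
{(T,S) | T = J·S, Q·S = 0}, then 𝒯 = {T | A·T + conj(A)·conj(T) = 0} is the image
{J·S + conj(S) | Q·S = 0}, and dim_ℝ 𝒯 = dim_ℂ ker Q. -/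
theorem real_solution_space_parametrization (n p q : ℕ)
    (A : Matrix (Fin p) (Fin n) ℂ)
    (J : Matrix (Fin n) (Fin n) ℂ) (Q : Matrix (Fin q) (Fin n) ℂ)
    (hJQ : {TS : (Fin n → ℂ) × (Fin n → ℂ) |
        A.mulVec TS.1 + (A.map (starRingEnd ℂ)).mulVec TS.2 = 0} =
      {TS : (Fin n → ℂ) × (Fin n → ℂ) | TS.1 = J.mulVec TS.2 ∧ Q.mulVec TS.2 = 0}) :
    {T : Fin n → ℂ |
        A.mulVec T + (A.map (starRingEnd ℂ)).mulVec (fun i => (starRingEnd ℂ) (T i)) = 0} =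
      {T : Fin n → ℂ | ∃ S : Fin n → ℂ, Q.mulVec S = 0 ∧
        T = J.mulVec S + fun i => (starRingEnd ℂ) (S i)} ∧
    ∃ V : Submodule ℝ (Fin n → ℂ),
      (∀ T : Fin n → ℂ, T ∈ V ↔
        A.mulVec T + (A.map (starRingEnd ℂ)).mulVec (fun i => (starRingEnd ℂ) (T i)) = 0) ∧
      Module.finrank ℝ V = Module.finrank ℂ (LinearMap.ker Q.mulVecLin) := by
  have hpair : ∀ T S : Fin n → ℂ, A.mulVec T + (A.map (starRingEnd ℂ)).mulVec S = 0 ↔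
      T = J.mulVec S ∧ Q.mulVec S = 0 := fun T S => Set.ext_iff.mp hJQ (T, S)
  have hmem : ∀ T, T ∈ realSolutionSpace A ↔
      T = J.mulVec (conjVec _ T) ∧ Q.mulVec (conjVec _ T) = 0 := fun T => hpair T (conjVec _ T)
  have himage : ∀ S, Q.mulVec S = 0 → J.mulVec S + conjVec _ S ∈ realSolutionSpace A :=
    fun S hS => add_conjVec_mem_realSolutionSpace ((hpair _ _).2 ⟨rfl, hS⟩)
  refine ⟨?_, realSolutionSpace A, fun T => Iff.rfl, ?_⟩
  · ext T
    refine ⟨fun hT => ?_, ?_⟩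
    · obtain ⟨hJ, hQ⟩ := (hmem T).1 hT
      refine ⟨(1 / 2 : ℂ) • conjVec _ T, by rw [mulVec_smul, hQ, smul_zero], ?_⟩
      rw [← conjVec_eq, mulVec_smul, ← hJ, conjVec_smul, conjVec_conjVec, ← add_smul]
      norm_num [conj_ofNat]
    · rintro ⟨S, hS, rfl⟩
      exact himage S hS
  · let f : realSolutionSpace A →ₗ[ℝ] LinearMap.ker Q.mulVecLin :=
      { toFun := fun T => ⟨conjVec _ T, ((hmem T).1 T.2).2⟩
        map_add' := fun x y => Subtype.ext (map_add (conjVec _) x.1 y.1)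
        map_smul' := fun c x => Subtype.ext (map_smul (conjVec _) c x.1) }
    have hf : ∀ x, (f x : Fin n → ℂ) = conjVec _ x.1 := fun _ => rfl
    apply finrank_real_eq_finrank_complex_of_bijective f
    constructor
    · rintro ⟨x, y⟩ ⟨x', y'⟩ h
      have h₁ : conjVec _ x.1 + I • conjVec _ y.1 = conjVec _ x'.1 + I • conjVec _ y'.1 :=
        congrArg Subtype.val h
      have h₂ := congrArg J.mulVec h₁
      simp only [mulVec_add, mulVec_smul, ← ((hmem _).1 (Subtype.property _)).1] at h₂
      have h₃ := congrArg (conjVec _) h₁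
      simp only [map_add, conjVec_smul, conjVec_conjVec, conj_I] at h₃
      refine Prod.ext (Subtype.ext (funext fun i => ?_)) (Subtype.ext (funext fun i => ?_))
      · have h₂ := congrFun h₂ i
        have h₃ := congrFun h₃ i
        simp only [Pi.add_apply, Pi.smul_apply, smul_eq_mul] at h₂ h₃
        linear_combination (h₂ + h₃) / 2
      · have h₂ := congrFun h₂ i
        have h₃ := congrFun h₃ i
        simp only [Pi.add_apply, Pi.smul_apply, smul_eq_mul] at h₂ h₃
        refine mul_left_cancel₀ I_ne_zero ?_
        linear_combination (h₂ - h₃) / 2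
    · rintro ⟨S, hS⟩
      have hQ : ∀ c : ℂ, Q.mulVec (c • S) = 0 := fun c => by
        rw [mulVec_smul, show Q.mulVec S = 0 from hS, smul_zero]
      refine ⟨(⟨_, himage _ (hQ (1 / 2))⟩, ⟨_, himage _ (hQ (-I / 2))⟩), Subtype.ext ?_⟩
      simp only [Submodule.coe_add, Submodule.coe_smul, hf, map_add, conjVec_conjVec,
        mulVec_smul, conjVec_smul]
      ext i
      simp only [Pi.add_apply, Pi.smul_apply, smul_eq_mul, map_div₀, map_neg, map_one, conj_I,
        map_ofNat]
      linear_combination (conjVec _ (J.mulVec S) i - S i) / 2 * I_mul_I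
end
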